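/- arXiv:1801.00419 — 5 statements merged into one kernel-verified Lean document; each statement's English description precedes it below -/
import Mathlib

section
/- Let τ_n be a topology on 𝒪^n(ℱ_n), let ℱ_{n+1} ⊆ 𝒫(𝒪^n(ℱ_n)), and let τ_{n+1} be the topology on 𝒪^{n+1}(ℱ_{n+1}) consisting of all ℍ ⊆ 𝒪^{n+1}(ℱ_{n+1}) with {O^n(U) ∈ 𝒪^n(ℱ_n) : O^{n+1}(U) ∈ ℍ} ∈ τ_n. If the topology t_{ℱ_n}(τ_n) on C(Y,Z) is splitting, then the topology t_{ℱ_{n+1}}(τ_{n+1}) on C(Y,Z) is splitting. -/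
open TopologicalSpace Set Topology

universe u v w

/-- Iterated stage types: `Stage Y 0 = 𝒪(Y)` and `Stage Y (k+1)` is the type in which the
level-`(k+1)` objects `O^{k+1}(U)` live. -/
@[reducible] def Stage (Y : Type u) [TopologicalSpace Y] : ℕ → Type u
  | 0 => Opens Y
  | k + 1 => Set (Set (Stage Y k))

/-- `famO F k U` is `O^{k+1}(U)`, where the family `ℱ_{k+1}` is `F k`.
So `famO F 0 U = O¹(U) = {φ ∈ ℱ₁ : U ∈ φ}` and
`famO F (k+1) U = O^{k+2}(U) = {φ ∈ ℱ_{k+2} : O^{k+1}(U) ∈ φ}`. -/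
def famO {Y : Type u} [TopologicalSpace Y] (F : ∀ k, Set (Set (Stage Y k))) :
    ∀ k, Opens Y → Stage Y (k + 1)
  | 0, U => {φ ∈ F 0 | U ∈ φ}
  | k + 1, U => {φ ∈ F (k + 1) | famO F k U ∈ φ}

variable {Y : Type u} [TopologicalSpace Y]

/-- The set `𝒪^{m+1}(ℱ_{m+1}) = {O^{m+1}(U) : U ∈ 𝒪(Y)}`, as a type. -/
abbrev OmegaN (F : ∀ k, Set (Set (Stage Y k))) (m : ℕ) : Type u :=
  {s : Stage Y (m + 1) // s ∈ Set.range (famO F m)}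

/-- The map `Φ_{ℱ_{m+1}} : 𝒪(Y) → 𝒪^{m+1}(ℱ_{m+1})`, `U ↦ O^{m+1}(U)`. -/
def onMap (F : ∀ k, Set (Set (Stage Y k))) (m : ℕ) (U : Opens Y) : OmegaN F m :=
  ⟨famO F m U, Set.mem_range_self U⟩

/-- The `ℱ_{m+1}(τ)`-family-open topology `t_{ℱ_{m+1}}(τ)` on `C(Y, Z)`: it is generated by the
subbasic sets `⟨ℍ, U⟩ = {f ∈ C(Y,Z) : O^{m+1}(f⁻¹(U)) ∈ ℍ}`, `ℍ ∈ τ`, `U ∈ 𝒪(Z)`. -/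
def famTop (Z : Type v) [TopologicalSpace Z] {Y : Type u} [TopologicalSpace Y]
    (F : ∀ k, Set (Set (Stage Y k))) (m : ℕ)
    (τ : TopologicalSpace (OmegaN F m)) : TopologicalSpace C(Y, Z) :=
  TopologicalSpace.generateFrom
    {S | ∃ (H : Set (OmegaN F m)) (U : Opens Z), IsOpen[τ] H ∧
      S = {f : C(Y, Z) | onMap F m (Opens.comap f U) ∈ H}}

/-- A topology `t` on `C(Y, Z)` is splitting if for every topological space `X`, continuity of
`F : X × Y → Z` implies continuity of `F̂ : X → C_t(Y, Z)`, `F̂(x)(y) = F(x, y)`. -/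
def IsSplittingTop {Y : Type u} {Z : Type v} [TopologicalSpace Y] [TopologicalSpace Z]
    (t : TopologicalSpace C(Y, Z)) : Prop :=
  ∀ (X : Type w) [tX : TopologicalSpace X] (Fc : X × Y → Z) (hFc : Continuous Fc),
    Continuous[tX, t] fun x : X =>
      (⟨fun y => Fc (x, y), hFc.comp (Continuous.prodMk_right x)⟩ : C(Y, Z))

theorem famO_succ_eq_of_famO_eq {F : ∀ k, Set (Set (Stage Y k))} {m : ℕ} {U V : Opens Y}
    (h : famO F m U = famO F m V) : famO F (m + 1) U = famO F (m + 1) V := by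
  simp only [famO, h]

/-- The family-open topology one level up is coarser. -/
theorem famTop_le_famTop_succ (Z : Type v) [TopologicalSpace Z]
    (F : ∀ k, Set (Set (Stage Y k))) (m : ℕ) (τ : TopologicalSpace (OmegaN F m))
    (τ' : TopologicalSpace (OmegaN F (m + 1)))
    (hτ' : ∀ H : Set (OmegaN F (m + 1)), IsOpen[τ'] H →
      IsOpen[τ] {s : OmegaN F m |
        ∃ U : Opens Y, famO F m U = s.1 ∧ onMap F (m + 1) U ∈ H}) :
    famTop Z F m τ ≤ famTop Z F (m + 1) τ' := by
  refine le_generateFrom ?_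
  rintro _ ⟨H, U, hH, rfl⟩
  refine isOpen_generateFrom_of_mem ⟨_, U, hτ' H hH, Set.ext fun f => ⟨fun hf => ?_, ?_⟩⟩
  · exact ⟨Opens.comap f U, rfl, hf⟩
  · rintro ⟨V, hV, hVH⟩
    have hVU : onMap F (m + 1) V = onMap F (m + 1) (Opens.comap f U) :=
      Subtype.ext (famO_succ_eq_of_famO_eq hV)
    rwa [hVU] at hVH

/-- With `τ'` the topology on `𝒪^{n+1}(ℱ_{n+1})` induced from `τ` on `𝒪^n(ℱ_n)`: if
`t_{ℱ_n}(τ)` is splitting then so is `t_{ℱ_{n+1}}(τ')` (here `n = m + 1`). -/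
theorem stmt2 (Z : Type v) [TopologicalSpace Z] (F : ∀ k, Set (Set (Stage Y k)))
    (hF : ∀ k, ∀ φ ∈ F (k + 1), ∀ x ∈ φ, x ∈ Set.range (famO F k))
    (m : ℕ) (τ : TopologicalSpace (OmegaN F m)) (τ' : TopologicalSpace (OmegaN F (m + 1)))
    (hτ' : ∀ H : Set (OmegaN F (m + 1)),
      IsOpen[τ'] H ↔
        IsOpen[τ] {s : OmegaN F m |
          ∃ U : Opens Y, famO F m U = s.1 ∧ onMap F (m + 1) U ∈ H})
    (hsp : IsSplittingTop.{u, v, w} (famTop Z F m τ)) :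
    IsSplittingTop.{u, v, w} (famTop Z F (m + 1) τ') := by
  intro X tX Fc hFc
  exact continuous_le_rng (famTop_le_famTop_succ Z F m τ τ' fun H => (hτ' H).1) (hsp X Fc hFc)
end

section
/- Let 𝒜 be an arbitrary family of topological spaces and τ_n a topology on 𝒪^n(ℱ_n). The topology t_{ℱ_n}(τ_n) on C(Y,Z) is 𝒜-splitting if and only if for every space X ∈ 𝒜, the continuity of a map F : X×Y → Z implies the continuity with respect to the first variable of the map F̄_n : X × 𝒪(Z) → 𝒪^n(ℱ_n) defined by F̄_n(x,U) = O^n(F_x⁻¹(U)), where F_x(y) = F(x,y). -/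
open TopologicalSpace Set Topology

universe u v w

variable {Y : Type u} [TopologicalSpace Y]

/-- A topology `t` on `C(Y, Z)` is `𝒜`-splitting if for every topological space `X` in the
family `𝒜`, continuity of `F : X × Y → Z` implies continuity of `F̂ : X → C_t(Y, Z)`. -/
def IsASplittingTop {Y : Type u} {Z : Type v} [TopologicalSpace Y] [TopologicalSpace Z]
    (𝒜 : (X : Type w) → TopologicalSpace X → Prop) (t : TopologicalSpace C(Y, Z)) : Prop :=
  ∀ (X : Type w) [tX : TopologicalSpace X], 𝒜 X tX →
    ∀ (Fc : X × Y → Z) (hFc : Continuous Fc),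
      Continuous[tX, t] fun x : X =>
        (⟨fun y => Fc (x, y), hFc.comp (Continuous.prodMk_right x)⟩ : C(Y, Z))

/-- A map into `C(Y, Z)` with the family-open topology is continuous iff all the maps
`x ↦ O^{m+1}((g x)⁻¹(U))` are. -/
theorem continuous_famTop_iff {Z : Type v} [TopologicalSpace Z]
    {F : ∀ k, Set (Set (Stage Y k))} {m : ℕ} {τ : TopologicalSpace (OmegaN F m)}
    {X : Type w} [tX : TopologicalSpace X] {g : X → C(Y, Z)} :
    Continuous[tX, famTop Z F m τ] g ↔
      ∀ U : Opens Z, Continuous[tX, τ] fun x => onMap F m (Opens.comap (g x) U) := by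
  rw [famTop, continuous_generateFrom_iff]
  constructor
  · intro h U
    exact continuous_def.2 fun H hH => h _ ⟨H, U, hH, rfl⟩
  · rintro h _ ⟨H, U, hH, rfl⟩
    exact continuous_def.1 (h U) H hH

/-- The topology `t_{ℱ_n}(τ)` on `C(Y,Z)` is `𝒜`-splitting iff for every `X ∈ 𝒜`, continuity
of `F : X × Y → Z` implies continuity with respect to the first variable of
`F̄_n : X × 𝒪(Z) → 𝒪^n(ℱ_n)`, `F̄_n(x, U) = O^n(F_x⁻¹(U))` (here `n = m + 1`). -/
theorem stmt7 (Z : Type v) [TopologicalSpace Z] (F : ∀ k, Set (Set (Stage Y k)))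
    (hF : ∀ k, ∀ φ ∈ F (k + 1), ∀ x ∈ φ, x ∈ Set.range (famO F k))
    (m : ℕ) (τ : TopologicalSpace (OmegaN F m))
    (𝒜 : (X : Type w) → TopologicalSpace X → Prop) :
    IsASplittingTop 𝒜 (famTop Z F m τ) ↔
      ∀ (X : Type w) [tX : TopologicalSpace X], 𝒜 X tX →
        ∀ (Fc : X × Y → Z) (hFc : Continuous Fc) (U : Opens Z),
          Continuous[tX, τ] fun x : X =>
            onMap F m (Opens.comap
              (⟨fun y => Fc (x, y), hFc.comp (Continuous.prodMk_right x)⟩ : C(Y, Z)) U) := by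
  simp only [IsASplittingTop, continuous_famTop_iff]
end

section
/- Let 𝒜 be an arbitrary family of topological spaces. If the map Φ_{ℱ_n} : 𝒪(Y) → 𝒪^n(ℱ_n), Φ_{ℱ_n}(U) = O^n(U), is continuous when both 𝒪(Y) and 𝒪^n(ℱ_n) carry their Scott topologies (with respect to the inclusion order), then the topology t_{ℱ_n}(τ_Sc(𝒪^n(ℱ_n))) on C(Y,Z) is 𝒜-splitting, for every topological space Z. -/
open TopologicalSpace Set Topology

universe u v w

variable {Y : Type u} [TopologicalSpace Y]

/-- A subset of a poset is Scott open if it is an upper set and every directed set whose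
supremum lies in it meets it. -/
def ScottOpen {P : Type*} [Preorder P] (H : Set P) : Prop :=
  IsUpperSet H ∧ ∀ D : Set P, D.Nonempty → DirectedOn (· ≤ ·) D →
    ∀ a : P, IsLUB D a → a ∈ H → (D ∩ H).Nonempty

/-- The Scott topology on a poset: the Scott open sets form a topology, so the topology
generated by them has exactly the Scott open sets as its open sets. -/
def scottTop (P : Type*) [Preorder P] : TopologicalSpace P :=
  TopologicalSpace.generateFrom {H : Set P | ScottOpen H}

/-- The slice `{y | (x, y) ∈ W}` of an open subset `W` of a product. -/
def openSlice {X : Type w} [TopologicalSpace X] (W : Opens (X × Y)) (x : X) : Opens Y :=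
  ⟨{y | (x, y) ∈ W}, W.isOpen.preimage (Continuous.prodMk_right x)⟩

/-- The slices of an open subset of a product depend continuously on the base point, for the
Scott topology on `Opens Y`. -/
theorem continuous_openSlice {X : Type w} [tX : TopologicalSpace X] (W : Opens (X × Y)) :
    Continuous[tX, scottTop (Opens Y)] (openSlice W) := by
  refine continuous_generateFrom_iff.2 fun H hH => isOpen_iff_mem_nhds.2 fun x hx => ?_
  obtain ⟨V, ⟨N, hN, hNV⟩, hV⟩ := hH.2
    {V : Opens Y | ∃ N ∈ 𝓝 x, ∀ x' ∈ N, V ≤ openSlice W x'}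
    ⟨⊥, univ, Filter.univ_mem, fun _ _ => bot_le⟩
    (by
      rintro V₁ ⟨N₁, h₁, hV₁⟩ V₂ ⟨N₂, h₂, hV₂⟩
      exact ⟨V₁ ⊔ V₂, ⟨N₁ ∩ N₂, Filter.inter_mem h₁ h₂,
        fun x' hx' => sup_le (hV₁ x' hx'.1) (hV₂ x' hx'.2)⟩, le_sup_left, le_sup_right⟩)
    (openSlice W x)
    ⟨fun V ⟨N, hN, hNV⟩ => hNV x (mem_of_mem_nhds hN), fun B hB y hy => by
      obtain ⟨N, V, hN, hV, hxN, hyV, hNV⟩ := isOpen_prod_iff.1 W.isOpen x y hy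
      exact hB (a := ⟨V, hV⟩) ⟨N, hN.mem_nhds hxN, fun x' hx' y' hy' => hNV ⟨hx', hy'⟩⟩ hyV⟩
    hx
  exact Filter.mem_of_superset hN fun x' hx' => hH.1 (hNV x' hx') hV

/-- If `Φ_{ℱ_n} : 𝒪(Y) → 𝒪^n(ℱ_n)`, `U ↦ O^n(U)`, is Scott continuous, then the topology
`t_{ℱ_n}(τ_Sc(𝒪^n(ℱ_n)))` on `C(Y,Z)` is `𝒜`-splitting for every topological space `Z`
(here `n = m + 1`). -/
theorem stmt9 (F : ∀ k, Set (Set (Stage Y k)))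
    (hF : ∀ k, ∀ φ ∈ F (k + 1), ∀ x ∈ φ, x ∈ Set.range (famO F k))
    (m : ℕ) (𝒜 : (X : Type w) → TopologicalSpace X → Prop)
    (hΦ : Continuous[scottTop (Opens Y), scottTop (OmegaN F m)] (onMap F m)) :
    ∀ (Z : Type v) [TopologicalSpace Z],
      IsASplittingTop 𝒜 (famTop Z F m (scottTop (OmegaN F m))) := by
  intro Z _ X tX _ Fc hFc
  refine continuous_generateFrom_iff.2 ?_
  rintro _ ⟨H, U, hH, rfl⟩
  let _ := scottTop (Opens Y)
  let _ := scottTop (OmegaN F m)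
  exact hH.preimage (hΦ.comp (continuous_openSlice (Opens.comap ⟨Fc, hFc⟩ U)))
end

section
/- Let 𝒜 be an arbitrary family of topological spaces and let ℱ₁ be a subset of the Scott topology τ_Sc(𝒪(Y)). Then the topology t_{ℱ₁}(τ_Sc(𝒪¹(ℱ₁))) on C(Y,Z), where 𝒪¹(ℱ₁) carries its Scott topology with respect to inclusion, is 𝒜-splitting. -/
open TopologicalSpace Set Topology

universe u v w

/-- `O¹(U) = {φ ∈ ℱ₁ : U ∈ φ}`. -/
def O1 {Y : Type u} [TopologicalSpace Y] (F1 : Set (Set (Opens Y))) (U : Opens Y) :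
    Set (Set (Opens Y)) :=
  {φ ∈ F1 | U ∈ φ}

variable {Y : Type u} [TopologicalSpace Y]

/-- The set `𝒪¹(ℱ₁) = {O¹(U) : U ∈ 𝒪(Y)}`, as a type. -/
abbrev Omega1 (F1 : Set (Set (Opens Y))) : Type u :=
  {s : Set (Set (Opens Y)) // s ∈ Set.range (O1 F1)}

/-- The `ℱ₁(τ)`-family-open topology `t_{ℱ₁}(τ)` on `C(Y, Z)`. -/
def famTop1 (Z : Type v) [TopologicalSpace Z] {Y : Type u} [TopologicalSpace Y]
    (F1 : Set (Set (Opens Y))) (τ : TopologicalSpace (Omega1 F1)) : TopologicalSpace C(Y, Z) :=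
  TopologicalSpace.generateFrom
    {S | ∃ (H : Set (Omega1 F1)) (U : Opens Z), IsOpen[τ] H ∧
      S = {f : C(Y, Z) |
        (⟨O1 F1 (Opens.comap f U), Set.mem_range_self _⟩ : Omega1 F1) ∈ H}}

theorem monotone_O1 {F1 : Set (Set (Opens Y))} (hF1 : ∀ φ ∈ F1, ScottOpen φ) :
    Monotone (O1 F1) :=
  fun _ _ hUV φ hφ => ⟨hφ.1, (hF1 φ hφ.1).1 hUV hφ.2⟩

/-- If `ℱ₁` consists of Scott open sets, then `O¹ : 𝒪(Y) → 𝒪¹(ℱ₁)` is Scott continuous. -/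
theorem ScottOpen.preimage_O1 {F1 : Set (Set (Opens Y))} (hF1 : ∀ φ ∈ F1, ScottOpen φ)
    {H : Set (Omega1 F1)} (hH : ScottOpen H) :
    ScottOpen {V : Opens Y | (⟨O1 F1 V, Set.mem_range_self V⟩ : Omega1 F1) ∈ H} := by
  set q : Opens Y → Omega1 F1 := fun V => ⟨O1 F1 V, Set.mem_range_self V⟩
  have hq : Monotone q := fun _ _ hUV => monotone_O1 hF1 hUV
  refine ⟨fun U V hUV hU => hH.1 (hq hUV) hU, fun D hne hdir a ha haH => ?_⟩
  have hlub : IsLUB (q '' D) (q a) := by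
    refine ⟨hq.mem_upperBounds_image ha.1, fun b hb φ hφ => ?_⟩
    obtain ⟨d, hdD, hdφ⟩ := (hF1 φ hφ.1).2 D hne hdir a ha hφ.2
    exact hb (mem_image_of_mem q hdD) ⟨hφ.1, hdφ⟩
  have hqdir : DirectedOn (· ≤ ·) (q '' D) := by
    rintro _ ⟨c, hc, rfl⟩ _ ⟨d, hd, rfl⟩
    obtain ⟨e, he, hce, hde⟩ := hdir c hc d hd
    exact ⟨q e, mem_image_of_mem q he, hq hce, hq hde⟩
  obtain ⟨_, ⟨d, hd, rfl⟩, hdH⟩ := hH.2 _ (hne.image q) hqdir (q a) hlub haH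
  exact ⟨d, hd, hdH⟩

/-- The slices of an open subset of `X × Y` depend continuously on the point of `X`, with respect
to the Scott topology on `𝒪(Y)`. -/
theorem ScottOpen.isOpen_setOf_slice_mem {X : Type w} [TopologicalSpace X] {G : Set (Opens Y)}
    (hG : ScottOpen G) (W : Opens (X × Y)) :
    IsOpen {x : X | Opens.comap ⟨fun y => (x, y), Continuous.prodMk_right x⟩ W ∈ G} := by
  refine isOpen_iff_mem_nhds.2 fun x hx => ?_
  let D : Set (Opens Y) := {V | ∃ N ∈ 𝓝 x, N ×ˢ (V : Set Y) ⊆ W}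
  have hne : D.Nonempty := ⟨⊥, univ, Filter.univ_mem, by simp⟩
  have hdir : DirectedOn (· ≤ ·) D := by
    rintro V ⟨N, hN, hNV⟩ V' ⟨N', hN', hNV'⟩
    refine ⟨V ⊔ V', ⟨N ∩ N', Filter.inter_mem hN hN', ?_⟩, le_sup_left, le_sup_right⟩
    rintro ⟨a, y⟩ ⟨ha, hy | hy⟩
    · exact hNV ⟨ha.1, hy⟩
    · exact hNV' ⟨ha.2, hy⟩
  have hlub : IsLUB D (Opens.comap ⟨fun y => (x, y), Continuous.prodMk_right x⟩ W) := by
    refine ⟨?_, fun b hb y hy => ?_⟩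
    · rintro V ⟨N, hN, hNV⟩ y hy
      exact hNV ⟨mem_of_mem_nhds hN, hy⟩
    · obtain ⟨N, V, hN, hxN, hV, hyV, hNV⟩ := mem_nhds_prod_iff'.1 (W.isOpen.mem_nhds hy)
      have hVD : (⟨V, hV⟩ : Opens Y) ∈ D := ⟨N, hN.mem_nhds hxN, hNV⟩
      exact hb hVD hyV
  obtain ⟨V, ⟨N, hN, hNV⟩, hVG⟩ := hG.2 D hne hdir _ hlub hx
  exact Filter.mem_of_superset hN fun a ha => hG.1 (fun y hy => hNV ⟨ha, hy⟩) hVG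

/-- The sets satisfying `ScottOpen` are closed under the operations generating a topology. -/
theorem scottOpen_of_isOpen_scottTop {P : Type*} [Preorder P] {H : Set P}
    (hH : IsOpen[scottTop P] H) : ScottOpen H := by
  induction hH with
  | basic s hs => exact hs
  | univ => exact ⟨isUpperSet_univ, fun D hne _ _ _ _ => by simpa using hne⟩
  | inter s t _ _ hs ht =>
    refine ⟨hs.1.inter ht.1, fun D hne hdir a ha has => ?_⟩
    obtain ⟨c, hcD, hcs⟩ := hs.2 D hne hdir a ha has.1
    obtain ⟨d, hdD, hdt⟩ := ht.2 D hne hdir a ha has.2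
    obtain ⟨e, heD, hce, hde⟩ := hdir c hcD d hdD
    exact ⟨e, heD, hs.1 hce hcs, ht.1 hde hdt⟩
  | sUnion S _ hS =>
    refine ⟨isUpperSet_sUnion fun s hs => (hS s hs).1, ?_⟩
    rintro D hne hdir a ha ⟨s, hs, has⟩
    obtain ⟨d, hdD, hds⟩ := (hS s hs).2 D hne hdir a ha has
    exact ⟨d, hdD, s, hs, hds⟩

/-- If `ℱ₁ ⊆ τ_Sc(𝒪(Y))`, then the topology `t_{ℱ₁}(τ_Sc(𝒪¹(ℱ₁)))` on `C(Y,Z)` is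
`𝒜`-splitting. -/
theorem stmt13 {Z : Type v} [TopologicalSpace Z] (F1 : Set (Set (Opens Y)))
    (hF1 : ∀ φ ∈ F1, ScottOpen φ)
    (𝒜 : (X : Type w) → TopologicalSpace X → Prop) :
    IsASplittingTop 𝒜 (famTop1 Z F1 (scottTop (Omega1 F1))) := by
  intro X _ _ Fc hFc
  refine continuous_generateFrom_iff.2 ?_
  rintro _ ⟨H, U, hH, rfl⟩
  exact ((scottOpen_of_isOpen_scottTop hH).preimage_O1 hF1).isOpen_setOf_slice_mem
    (Opens.comap ⟨Fc, hFc⟩ U)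
end

section
/- Let X, Y, Z be topological spaces and let F : X×Y → Z be continuous. Then the map F* : X × 𝒪(Z) → 𝒪(Y), F*(x,U) = F_x⁻¹(U) (where F_x(y) = F(x,y)), is Scott continuous with respect to the first variable: for every fixed open set U ⊆ Z, the map x ↦ F_x⁻¹(U) from X to 𝒪(Y) equipped with the Scott topology is continuous. -/
open TopologicalSpace Set Topology

universe u v w

/-- For every continuous `F : X × Y → Z` and every open `U ⊆ Z`, the map `x ↦ F_x⁻¹(U)` from
`X` to `𝒪(Y)` equipped with the Scott topology (whose open sets are the families of opens that
are upward closed and such that any union of opens belonging to them admits a finite subfamily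
whose union belongs to them) is continuous. -/
theorem stmt17 {X : Type w} {Y : Type u} {Z : Type v}
    [tX : TopologicalSpace X] [TopologicalSpace Y] [TopologicalSpace Z]
    (Fc : X × Y → Z) (hFc : Continuous Fc) (U : Set Z) (hU : IsOpen U) :
    Continuous[tX,
      TopologicalSpace.generateFrom {H : Set (Opens Y) |
        (∀ W ∈ H, ∀ V : Opens Y, W ≤ V → V ∈ H) ∧
        (∀ S : Set (Opens Y), sSup S ∈ H →
          ∃ t : Finset (Opens Y), ↑t ⊆ S ∧ sSup (↑t : Set (Opens Y)) ∈ H)}]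
      fun x : X =>
        (⟨(fun y => Fc (x, y)) ⁻¹' U,
          hU.preimage (hFc.comp (Continuous.prodMk_right x))⟩ : Opens Y) := by
  refine continuous_generateFrom_iff.2 fun H ⟨hup, hfin⟩ => isOpen_iff_mem_nhds.2 fun x hx => ?_
  set G : X → Opens Y := fun x => ⟨(fun y => Fc (x, y)) ⁻¹' U,
    hU.preimage (hFc.comp (Continuous.prodMk_right x))⟩
  have hle : G x ≤ sSup {V : Opens Y | ∀ᶠ x' in 𝓝 x, V ≤ G x'} := by
    intro y hy
    obtain ⟨A, B, hA, hB, hxA, hyB, hAB⟩ := isOpen_prod_iff.1 (hU.preimage hFc) x y hy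
    refine Opens.mem_sSup.2 ⟨⟨B, hB⟩, ?_, hyB⟩
    filter_upwards [hA.mem_nhds hxA] with x' hx' y' hy'
    exact hAB (mk_mem_prod hx' hy')
  obtain ⟨t, htS, ht⟩ := hfin _ (hup _ hx _ hle)
  have hev : ∀ᶠ x' in 𝓝 x, ∀ V ∈ t, V ≤ G x' :=
    (Filter.eventually_all_finset t).2 fun V hV => htS hV
  filter_upwards [hev] with x' hx'
  exact hup _ ht _ (sSup_le hx')
end
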